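/- Ξ̂∧-Permutation Lemma: let g : C ⊢ D be a Ξ̂∧_{p,B}-term of PN such that x₁ and ¬x₂ are respectively the occurrences within D of p and ¬p in the crown of the head Ξ̂∧_{p,B} of g, and let f : D ⊢ E be an arrow term of DS^{¬p} such that E has an occurrence y₁ of p and an occurrence ¬y₂ of ¬p within a subformula occurrence of E of the form y₁ ∨ ¬y₂ or ¬y₂ ∨ y₁, and x_i is linked to y_i in f for i ∈ {1,2}. Then there is a Θ̂∧_{p,B′}-term g′ : D′ ⊢ E of PN the crown of whose head is y₁ ∨ ¬y₂ or ¬y₂ ∨ y₁, and an arrow term f′ : C ⊢ D′ of DS^{¬p}, such that f ∘ g = g′ ∘ f′ holds in PN. -/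

import Mathlib

/-! ### The category Br of Brauerian split equivalences of finite ordinals

An arrow `m ⊢ n` of `Br` is represented as a relation on `ℕ ⊕ ℕ`, where
`Sum.inl i` (with `i < m`) is the source copy `i_s` and `Sum.inr j`
(with `j < n`) is the target copy `j_t`. -/

abbrev GRel : Type := (ℕ ⊕ ℕ) → (ℕ ⊕ ℕ) → Prop

/-- The identity arrow of `Br` on `n`: transversals `{i_s, i_t}` for `i < n`. -/
def gId (n : ℕ) : GRel := fun u v =>
  ∃ i, i < n ∧ (u = Sum.inl i ∨ u = Sum.inr i) ∧ (v = Sum.inl i ∨ v = Sum.inr i)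

/-- The Brauerian split equivalence whose transversals are `{i_s, (φ i)_t}` for `i < m`. -/
def gFun (m : ℕ) (φ : ℕ → ℕ) : GRel := fun u v =>
  ∃ i, i < m ∧ (u = Sum.inl i ∨ u = Sum.inr (φ i)) ∧ (v = Sum.inl i ∨ v = Sum.inr (φ i))

/-- The block transposition exchanging the first `a` and the last `b` elements. -/
def gSwap (a b : ℕ) : GRel :=
  gFun (a + b) (fun i => if i < a then i + b else i - a)

/-- `G Δ̂∧_{B,A}` with `a = GA`, `b = GB`: identity transversals on the stem `A`
together with caps joining the two copies of each letter occurrence of `B` in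
the crown `¬B ∨ B` of the target. -/
def gDelta (a b : ℕ) : GRel := fun u v =>
  (∃ i, i < a ∧ (u = Sum.inl i ∨ u = Sum.inr i) ∧ (v = Sum.inl i ∨ v = Sum.inr i)) ∨
  (∃ j, j < b ∧ (u = Sum.inr (a + j) ∨ u = Sum.inr (a + b + j)) ∧
                (v = Sum.inr (a + j) ∨ v = Sum.inr (a + b + j)))

/-- `G Σ̂∨_{B,A}` with `a = GA`, `b = GB`: identity transversals on the stem `A`
together with cups joining the two copies of each letter occurrence of `B` in
the crown `B ∧ ¬B` of the source. -/
def gSigma (a b : ℕ) : GRel := fun u v =>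
  (∃ i, i < a ∧ (u = Sum.inl (2*b + i) ∨ u = Sum.inr i) ∧
                (v = Sum.inl (2*b + i) ∨ v = Sum.inr i)) ∨
  (∃ j, j < b ∧ (u = Sum.inl j ∨ u = Sum.inl (b + j)) ∧
                (v = Sum.inl j ∨ v = Sum.inl (b + j)))

/-- Composition `P ∗ R` in `Br`: glue along the middle copy and take the
transitive closure, restricted to the outer copies. -/
def gComp (Pr R : GRel) : GRel := fun u v =>
  Relation.TransGen
    (fun x y : ℕ ⊕ ℕ ⊕ ℕ =>
      (∃ x' y', Sum.map id Sum.inl x' = x ∧ Sum.map id Sum.inl y' = y ∧ R x' y') ∨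
      (∃ x' y', Sum.inr x' = x ∧ Sum.inr y' = y ∧ Pr x' y'))
    (Sum.map id Sum.inr u) (Sum.map id Sum.inr v)

/-- Shift a split relation by `a` on the source side and by `d` on the target side. -/
def gShift (a d : ℕ) (R : GRel) : GRel := fun u v =>
  ∃ u' v', R u' v' ∧ u = Sum.map (· + a) (· + d) u' ∧ v = Sum.map (· + a) (· + d) v'

/-- Disjoint union of split relations: `G(f ξ g) = Gf ∪ Gg_{+GD}^{+GA}`. -/
def gPar (a d : ℕ) (R S : GRel) : GRel := fun u v => R u v ∨ gShift a d S u v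
/-! ### The language L∧,∨^{¬p} generated from `P ∪ P¬` (negation applied only to letters) -/

inductive Form (P : Type) : Type
  | pos : P → Form P
  | natom : P → Form P
  | conj : Form P → Form P → Form P
  | disj : Form P → Form P → Form P

infixr:70 " ⋏ " => Form.conj
infixr:66 " ⋎ " => Form.disj

/-- The number of occurrences of letters (elements of `P ∪ P¬`) in a formula. -/
def Form.size {P : Type} : Form P → ℕ
  | .pos _ => 1
  | .natom _ => 1
  | .conj A B => A.size + B.size
  | .disj A B => A.size + B.size
/-! ### Arrow terms of the category PN -/

inductive Term (P : Type) : Form P → Form P → Type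
  | id (A : Form P) : Term P A A
  | comp {A B C : Form P} : Term P B C → Term P A B → Term P A C
  | conj {A B D E : Form P} : Term P A D → Term P B E → Term P (A ⋏ B) (D ⋏ E)
  | disj {A B D E : Form P} : Term P A D → Term P B E → Term P (A ⋎ B) (D ⋎ E)
  | bConjTo (A B C : Form P) : Term P (A ⋏ (B ⋏ C)) ((A ⋏ B) ⋏ C)
  | bConjFrom (A B C : Form P) : Term P ((A ⋏ B) ⋏ C) (A ⋏ (B ⋏ C))
  | bDisjTo (A B C : Form P) : Term P (A ⋎ (B ⋎ C)) ((A ⋎ B) ⋎ C)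
  | bDisjFrom (A B C : Form P) : Term P ((A ⋎ B) ⋎ C) (A ⋎ (B ⋎ C))
  | cConj (A B : Form P) : Term P (A ⋏ B) (B ⋏ A)
  | cDisj (A B : Form P) : Term P (B ⋎ A) (A ⋎ B)
  | d (A B C : Form P) : Term P (A ⋏ (B ⋎ C)) ((A ⋏ B) ⋎ C)
  | delta (p : P) (A : Form P) : Term P A (A ⋏ (Form.natom p ⋎ Form.pos p))
  | sigma (p : P) (A : Form P) : Term P ((Form.pos p ⋏ Form.natom p) ⋎ A) A

infixr:80 " ⬝ " => Term.comp
infixr:70 " ⊼ " => Term.conj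
infixr:66 " ⊽ " => Term.disj

/-- The arrow `d^R_{C,B,A} : (C∨B)∧A ⊢ C∨(B∧A)`. -/
def dR {P : Type} (C B A : Form P) : Term P ((C ⋎ B) ⋏ A) (C ⋎ (B ⋏ A)) :=
  Term.cDisj C (B ⋏ A) ⬝ ((Term.cConj A B ⊽ Term.id C) ⬝
    (Term.d A B C ⬝ ((Term.id A ⊼ Term.cDisj B C) ⬝ Term.cConj (C ⋎ B) A)))

/-- `Σ̂∧_{p,A} = ĉ∧ ∘ Δ̂∧_{p,A} : A ⊢ (¬p∨p)∧A`. -/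
def sigmaConj {P : Type} (p : P) (A : Form P) :
    Term P A ((Form.natom p ⋎ Form.pos p) ⋏ A) :=
  Term.cConj A (Form.natom p ⋎ Form.pos p) ⬝ Term.delta p A

/-- `Δ̂∨_{p,A} = Σ̂∨_{p,A} ∘ ĉ∨ : A∨(p∧¬p) ⊢ A`. -/
def deltaDisj {P : Type} (p : P) (A : Form P) :
    Term P (A ⋎ (Form.pos p ⋏ Form.natom p)) A :=
  Term.sigma p A ⬝ Term.cDisj (Form.pos p ⋏ Form.natom p) A

/-- `Δ̂∧′_{p,A} = (1_A ∧ ĉ∨) ∘ Δ̂∧_{p,A} : A ⊢ A∧(p∨¬p)`. -/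
def delta' {P : Type} (p : P) (A : Form P) :
    Term P A (A ⋏ (Form.pos p ⋎ Form.natom p)) :=
  (Term.id A ⊼ Term.cDisj (Form.pos p) (Form.natom p)) ⬝ Term.delta p A

/-- `Σ̂∨′_{p,A} = Σ̂∨_{p,A} ∘ (ĉ∧ ∨ 1_A) : (¬p∧p)∨A ⊢ A`. -/
def sigma' {P : Type} (p : P) (A : Form P) :
    Term P ((Form.natom p ⋏ Form.pos p) ⋎ A) A :=
  Term.sigma p A ⬝ (Term.cConj (Form.natom p) (Form.pos p) ⊽ Term.id A)

/-- `Σ̂∧′_{p,A} = ĉ∧ ∘ Δ̂∧′_{p,A} : A ⊢ (p∨¬p)∧A`. -/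
def sigmaConj' {P : Type} (p : P) (A : Form P) :
    Term P A ((Form.pos p ⋎ Form.natom p) ⋏ A) :=
  Term.cConj A (Form.pos p ⋎ Form.natom p) ⬝ delta' p A

/-- `Δ̂∨′_{p,A} = Σ̂∨′_{p,A} ∘ ĉ∨ : A∨(¬p∧p) ⊢ A`. -/
def deltaDisj' {P : Type} (p : P) (A : Form P) :
    Term P (A ⋎ (Form.natom p ⋏ Form.pos p)) A :=
  sigma' p A ⬝ Term.cDisj (Form.natom p ⋏ Form.pos p) A
/-! ### The equations of DS, imposed on arrow terms -/

inductive Eqv {P : Type} : ∀ {A B : Form P}, Term P A B → Term P A B → Prop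
  -- equivalence and congruence
  | refl {A B : Form P} (f : Term P A B) : Eqv f f
  | symm {A B : Form P} {f g : Term P A B} : Eqv f g → Eqv g f
  | trans {A B : Form P} {f g h : Term P A B} : Eqv f g → Eqv g h → Eqv f h
  | congComp {A B C : Form P} {g g' : Term P B C} {f f' : Term P A B} :
      Eqv g g' → Eqv f f' → Eqv (g ⬝ f) (g' ⬝ f')
  | congConj {A B D E : Form P} {f f' : Term P A D} {g g' : Term P B E} :
      Eqv f f' → Eqv g g' → Eqv (f ⊼ g) (f' ⊼ g')
  | congDisj {A B D E : Form P} {f f' : Term P A D} {g g' : Term P B E} :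
      Eqv f f' → Eqv g g' → Eqv (f ⊽ g) (f' ⊽ g')
  -- (cat 1), (cat 2)
  | catIdR {A B : Form P} (f : Term P A B) : Eqv (f ⬝ Term.id A) f
  | catIdL {A B : Form P} (f : Term P A B) : Eqv (Term.id B ⬝ f) f
  | catAssoc {A B C D : Form P} (f : Term P A B) (g : Term P B C) (h : Term P C D) :
      Eqv (h ⬝ (g ⬝ f)) ((h ⬝ g) ⬝ f)
  -- bifunctorial equations (ξ 1), (ξ 2)
  | conjOne (A B : Form P) : Eqv (Term.id A ⊼ Term.id B) (Term.id (A ⋏ B))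
  | disjOne (A B : Form P) : Eqv (Term.id A ⊽ Term.id B) (Term.id (A ⋎ B))
  | conjTwo {A₁ B₁ C₁ A₂ B₂ C₂ : Form P} (g₁ : Term P B₁ C₁) (f₁ : Term P A₁ B₁)
      (g₂ : Term P B₂ C₂) (f₂ : Term P A₂ B₂) :
      Eqv ((g₁ ⬝ f₁) ⊼ (g₂ ⬝ f₂)) ((g₁ ⊼ g₂) ⬝ (f₁ ⊼ f₂))
  | disjTwo {A₁ B₁ C₁ A₂ B₂ C₂ : Form P} (g₁ : Term P B₁ C₁) (f₁ : Term P A₁ B₁)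
      (g₂ : Term P B₂ C₂) (f₂ : Term P A₂ B₂) :
      Eqv ((g₁ ⬝ f₁) ⊽ (g₂ ⬝ f₂)) ((g₁ ⊽ g₂) ⬝ (f₁ ⊽ f₂))
  -- naturality equations
  | bConjNat {A B C D E F : Form P} (f : Term P A D) (g : Term P B E) (h : Term P C F) :
      Eqv (((f ⊼ g) ⊼ h) ⬝ Term.bConjTo A B C) (Term.bConjTo D E F ⬝ (f ⊼ (g ⊼ h)))
  | bDisjNat {A B C D E F : Form P} (f : Term P A D) (g : Term P B E) (h : Term P C F) :
      Eqv (((f ⊽ g) ⊽ h) ⬝ Term.bDisjTo A B C) (Term.bDisjTo D E F ⬝ (f ⊽ (g ⊽ h)))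
  | cConjNat {A B D E : Form P} (f : Term P A D) (g : Term P B E) :
      Eqv ((g ⊼ f) ⬝ Term.cConj A B) (Term.cConj D E ⬝ (f ⊼ g))
  | cDisjNat {A B D E : Form P} (f : Term P A D) (g : Term P B E) :
      Eqv ((g ⊽ f) ⬝ Term.cDisj B A) (Term.cDisj E D ⬝ (f ⊽ g))
  | dNat {A B C D E F : Form P} (f : Term P A D) (g : Term P B E) (h : Term P C F) :
      Eqv (((f ⊼ g) ⊽ h) ⬝ Term.d A B C) (Term.d D E F ⬝ (f ⊼ (g ⊽ h)))
  -- (b̂ξ b̂ξ)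
  | bConjIso₁ (A B C : Form P) :
      Eqv (Term.bConjFrom A B C ⬝ Term.bConjTo A B C) (Term.id (A ⋏ (B ⋏ C)))
  | bConjIso₂ (A B C : Form P) :
      Eqv (Term.bConjTo A B C ⬝ Term.bConjFrom A B C) (Term.id ((A ⋏ B) ⋏ C))
  | bDisjIso₁ (A B C : Form P) :
      Eqv (Term.bDisjFrom A B C ⬝ Term.bDisjTo A B C) (Term.id (A ⋎ (B ⋎ C)))
  | bDisjIso₂ (A B C : Form P) :
      Eqv (Term.bDisjTo A B C ⬝ Term.bDisjFrom A B C) (Term.id ((A ⋎ B) ⋎ C))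
  -- (b̂ξ 5)
  | bConjPent (A B C D : Form P) :
      Eqv (Term.bConjFrom A B (C ⋏ D) ⬝ Term.bConjFrom (A ⋏ B) C D)
        ((Term.id A ⊼ Term.bConjFrom B C D) ⬝
          (Term.bConjFrom A (B ⋏ C) D ⬝ (Term.bConjFrom A B C ⊼ Term.id D)))
  | bDisjPent (A B C D : Form P) :
      Eqv (Term.bDisjFrom A B (C ⋎ D) ⬝ Term.bDisjFrom (A ⋎ B) C D)
        ((Term.id A ⊽ Term.bDisjFrom B C D) ⬝
          (Term.bDisjFrom A (B ⋎ C) D ⬝ (Term.bDisjFrom A B C ⊽ Term.id D)))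
  -- (ĉ∧ ĉ∧), (ĉ∨ ĉ∨)
  | cConjIso (A B : Form P) : Eqv (Term.cConj B A ⬝ Term.cConj A B) (Term.id (A ⋏ B))
  | cDisjIso (A B : Form P) : Eqv (Term.cDisj A B ⬝ Term.cDisj B A) (Term.id (A ⋎ B))
  -- (b̂∧ ĉ∧), (b̂∨ ĉ∨)
  | bcConj (A B C : Form P) :
      Eqv ((Term.id B ⊼ Term.cConj C A) ⬝ (Term.bConjFrom B C A ⬝
            (Term.cConj A (B ⋏ C) ⬝ (Term.bConjFrom A B C ⬝ (Term.cConj B A ⊼ Term.id C)))))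
        (Term.bConjFrom B A C)
  | bcDisj (A B C : Form P) :
      Eqv ((Term.id B ⊽ Term.cDisj A C) ⬝ (Term.bDisjFrom B C A ⬝
            (Term.cDisj (B ⋎ C) A ⬝ (Term.bDisjFrom A B C ⬝ (Term.cDisj A B ⊽ Term.id C)))))
        (Term.bDisjFrom B A C)
  -- (d ∧), (d ∨)
  | dConj (A B C D : Form P) :
      Eqv ((Term.bConjFrom A B C ⊽ Term.id D) ⬝ Term.d (A ⋏ B) C D)
        (Term.d A (B ⋏ C) D ⬝ ((Term.id A ⊼ Term.d B C D) ⬝ Term.bConjFrom A B (C ⋎ D)))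
  | dDisj (D C B A : Form P) :
      Eqv (Term.d D C (B ⋎ A) ⬝ (Term.id D ⊼ Term.bDisjFrom C B A))
        (Term.bDisjFrom (D ⋏ C) B A ⬝ ((Term.d D C B ⊽ Term.id A) ⬝ Term.d D (C ⋎ B) A))
  -- (d b̂∧), (d b̂∨)
  | dBConj (A B C D : Form P) :
      Eqv (dR (A ⋏ B) C D ⬝ (Term.d A B C ⊼ Term.id D))
        (Term.d A B (C ⋏ D) ⬝ ((Term.id A ⊼ dR B C D) ⬝ Term.bConjFrom A (B ⋎ C) D))
  | dBDisj (D C B A : Form P) :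
      Eqv ((Term.id D ⊽ Term.d C B A) ⬝ dR D C (B ⋎ A))
        (Term.bDisjFrom D (C ⋏ B) A ⬝ ((dR D C B ⊽ Term.id A) ⬝ Term.d (D ⋎ C) B A))
  -- (Δ̂∧ nat)
  | deltaNat {A D : Form P} (p : P) (f : Term P A D) :
      Eqv ((f ⊼ Term.id (Form.natom p ⋎ Form.pos p)) ⬝ Term.delta p A) (Term.delta p D ⬝ f)
  -- (Σ̂∨ nat)
  | sigmaNat {A D : Form P} (p : P) (f : Term P A D) :
      Eqv (f ⬝ Term.sigma p A) (Term.sigma p D ⬝ (Term.id (Form.pos p ⋏ Form.natom p) ⊽ f))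
  -- (b̂∧ Δ̂∧)
  | bDelta (A B : Form P) (p : P) :
      Eqv (Term.bConjFrom A B (Form.natom p ⋎ Form.pos p) ⬝ Term.delta p (A ⋏ B))
        (Term.id A ⊼ Term.delta p B)
  -- (b̂∨ Σ̂∨)
  | bSigma (p : P) (B A : Form P) :
      Eqv (Term.sigma p (B ⋎ A) ⬝ Term.bDisjFrom (Form.pos p ⋏ Form.natom p) B A)
        (Term.sigma p B ⊽ Term.id A)
  -- (d Σ̂∧)
  | dSigmaConj (p : P) (B C : Form P) :
      Eqv (Term.d (Form.natom p ⋎ Form.pos p) B C ⬝ sigmaConj p (B ⋎ C))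
        (sigmaConj p B ⊽ Term.id C)
  -- (d Δ̂∨)
  | dDeltaDisj (p : P) (C B : Form P) :
      Eqv (deltaDisj p (C ⋏ B) ⬝ Term.d C B (Form.pos p ⋏ Form.natom p))
        (Term.id C ⊼ deltaDisj p B)
  -- (Σ̂∨ Δ̂∧)
  | sigmaDelta (p : P) :
      Eqv (Term.sigma p (Form.pos p) ⬝
            (Term.d (Form.pos p) (Form.natom p) (Form.pos p) ⬝ Term.delta p (Form.pos p)))
        (Term.id (Form.pos p))
  -- (Σ̂∨′ Δ̂∧′)
  | sigmaDelta' (p : P) :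
      Eqv (sigma' p (Form.natom p) ⬝
            (Term.d (Form.natom p) (Form.pos p) (Form.natom p) ⬝ delta' p (Form.natom p)))
        (Term.id (Form.natom p))
/-- The functor `G` from DS to Br on arrow terms. -/
def Term.G {P : Type} : ∀ {A B : Form P}, Term P A B → GRel
  | _, _, .id A => gId A.size
  | _, _, .comp g f => gComp (Term.G g) (Term.G f)
  | _, _, @Term.conj _ A _ D _ f g => gPar A.size D.size (Term.G f) (Term.G g)
  | _, _, @Term.disj _ A _ D _ f g => gPar A.size D.size (Term.G f) (Term.G g)
  | _, _, .bConjTo A B C => gId (A.size + (B.size + C.size))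
  | _, _, .bConjFrom A B C => gId (A.size + B.size + C.size)
  | _, _, .bDisjTo A B C => gId (A.size + (B.size + C.size))
  | _, _, .bDisjFrom A B C => gId (A.size + B.size + C.size)
  | _, _, .cConj A B => gSwap A.size B.size
  | _, _, .cDisj A B => gSwap B.size A.size
  | _, _, .d A B C => gId (A.size + (B.size + C.size))
  | _, _, .delta _ A => gDelta A.size 1
  | _, _, .sigma _ A => gSigma A.size 1
/-! ### Occurrences of letters and subformula occurrences in L∧,∨^{¬p} -/

/-- The letter (element of `P ∪ P¬`, as an atomic formula) at the `(n+1)`-th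
letter-occurrence position of a formula. -/
def Form.letterAt {P : Type} : Form P → ℕ → Option (Form P)
  | .pos p, 0 => some (.pos p)
  | .pos _, _ + 1 => none
  | .natom p, 0 => some (.natom p)
  | .natom _, _ + 1 => none
  | .conj A B, n => if n < A.size then A.letterAt n else B.letterAt (n - A.size)
  | .disj A B, n => if n < A.size then A.letterAt n else B.letterAt (n - A.size)

/-- Directions for addressing subformula occurrences. -/
inductive Dir : Type
  | l
  | r
deriving DecidableEq

/-- The subformula occurrence of a formula at a given position (path). -/
def Form.subAt {P : Type} : Form P → List Dir → Option (Form P)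
  | A, [] => some A
  | .conj A _, .l :: π => A.subAt π
  | .conj _ B, .r :: π => B.subAt π
  | .disj A _, .l :: π => A.subAt π
  | .disj _ B, .r :: π => B.subAt π
  | .pos _, _ :: _ => none
  | .natom _, _ :: _ => none

/-- The number of letter occurrences strictly to the left of the subformula
occurrence at a given position. -/
def Form.offsetAt {P : Type} : Form P → List Dir → ℕ
  | _, [] => 0
  | .conj A _, .l :: π => A.offsetAt π
  | .conj A B, .r :: π => A.size + B.offsetAt π
  | .disj A _, .l :: π => A.offsetAt π
  | .disj A B, .r :: π => A.size + B.offsetAt π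
  | .pos _, _ :: _ => 0
  | .natom _, _ :: _ => 0

/-- The `(n+1)`-th occurrence of a letter in `A` is *linked* in `f : A ⊢ B` to the
`(m+1)`-th occurrence of the same letter in `B` when `{n_s, m_t}` belongs to the
partition corresponding to `Gf`. -/
def Linked {P : Type} {A B : Form P} (f : Term P A B) (n m : ℕ) : Prop :=
  Term.G f (Sum.inl n) (Sum.inr m)

/-- `f` is an arrow term of DS^{¬p}: it contains none of the primitive arrow
terms `Δ̂∧` and `Σ̂∨`. -/
def IsDSTerm {P : Type} : ∀ {A B : Form P}, Term P A B → Prop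
  | _, _, .delta _ _ => False
  | _, _, .sigma _ _ => False
  | _, _, .comp g f => IsDSTerm g ∧ IsDSTerm f
  | _, _, .conj f g => IsDSTerm f ∧ IsDSTerm g
  | _, _, .disj f g => IsDSTerm f ∧ IsDSTerm g
  | _, _, _ => True
/-! ### Ξ̂∧-terms and Θ̂∨-terms, with the positions and the path of the crown -/

/-- `IsXiConjTerm p g kp kn cp` says that `g` is a `Ξ̂∧_{p,B}`-term (a β-term whose
head is one of `Δ̂∧_{p,B}`, `Δ̂∧′_{p,B}`, `Σ̂∧_{p,B}`, `Σ̂∧′_{p,B}`), that within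
the *target* of `g` the occurrence of `p` in the crown of the head has position
`kp` and the occurrence of `¬p` has position `kn` (0-based, among letter
occurrences), and that the crown of the head is the subformula occurrence of the
target of `g` at the path `cp`. -/
inductive IsXiConjTerm {P : Type} (p : P) :
    ∀ {A B : Form P}, Term P A B → ℕ → ℕ → List Dir → Prop
  | delta (B : Form P) :
      IsXiConjTerm p (Term.delta p B) (B.size + 1) B.size [Dir.r]
  | delta' (B : Form P) :
      IsXiConjTerm p (delta' p B) B.size (B.size + 1) [Dir.r]
  | sigmaConj (B : Form P) :
      IsXiConjTerm p (sigmaConj p B) 1 0 [Dir.l]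
  | sigmaConj' (B : Form P) :
      IsXiConjTerm p (sigmaConj' p B) 0 1 [Dir.l]
  | conjL (A : Form P) {C D : Form P} {g : Term P C D} {kp kn : ℕ} {cp : List Dir} :
      IsXiConjTerm p g kp kn cp →
      IsXiConjTerm p (Term.id A ⊼ g) (A.size + kp) (A.size + kn) (Dir.r :: cp)
  | conjR (A : Form P) {C D : Form P} {g : Term P C D} {kp kn : ℕ} {cp : List Dir} :
      IsXiConjTerm p g kp kn cp →
      IsXiConjTerm p (g ⊼ Term.id A) kp kn (Dir.l :: cp)
  | disjL (A : Form P) {C D : Form P} {g : Term P C D} {kp kn : ℕ} {cp : List Dir} :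
      IsXiConjTerm p g kp kn cp →
      IsXiConjTerm p (Term.id A ⊽ g) (A.size + kp) (A.size + kn) (Dir.r :: cp)
  | disjR (A : Form P) {C D : Form P} {g : Term P C D} {kp kn : ℕ} {cp : List Dir} :
      IsXiConjTerm p g kp kn cp →
      IsXiConjTerm p (g ⊽ Term.id A) kp kn (Dir.l :: cp)

/-- `IsThetaDisjTerm p g kp kn cp` says that `g` is a `Θ̂∨_{p,B}`-term (a β-term
whose head is one of `Σ̂∨_{p,B}`, `Σ̂∨′_{p,B}`, `Δ̂∨_{p,B}`, `Δ̂∨′_{p,B}`), that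
within the *source* of `g` the occurrence of `p` in the crown of the head has
position `kp` and the occurrence of `¬p` has position `kn`, and that the crown of
the head is the subformula occurrence of the source of `g` at the path `cp`. -/
inductive IsThetaDisjTerm {P : Type} (p : P) :
    ∀ {A B : Form P}, Term P A B → ℕ → ℕ → List Dir → Prop
  | sigma (B : Form P) :
      IsThetaDisjTerm p (Term.sigma p B) 0 1 [Dir.l]
  | sigma' (B : Form P) :
      IsThetaDisjTerm p (sigma' p B) 1 0 [Dir.l]
  | deltaDisj (B : Form P) :
      IsThetaDisjTerm p (deltaDisj p B) B.size (B.size + 1) [Dir.r]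
  | deltaDisj' (B : Form P) :
      IsThetaDisjTerm p (deltaDisj' p B) (B.size + 1) B.size [Dir.r]
  | conjL (A : Form P) {C D : Form P} {g : Term P C D} {kp kn : ℕ} {cp : List Dir} :
      IsThetaDisjTerm p g kp kn cp →
      IsThetaDisjTerm p (Term.id A ⊼ g) (A.size + kp) (A.size + kn) (Dir.r :: cp)
  | conjR (A : Form P) {C D : Form P} {g : Term P C D} {kp kn : ℕ} {cp : List Dir} :
      IsThetaDisjTerm p g kp kn cp →
      IsThetaDisjTerm p (g ⊼ Term.id A) kp kn (Dir.l :: cp)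
  | disjL (A : Form P) {C D : Form P} {g : Term P C D} {kp kn : ℕ} {cp : List Dir} :
      IsThetaDisjTerm p g kp kn cp →
      IsThetaDisjTerm p (Term.id A ⊽ g) (A.size + kp) (A.size + kn) (Dir.r :: cp)
  | disjR (A : Form P) {C D : Form P} {g : Term P C D} {kp kn : ℕ} {cp : List Dir} :
      IsThetaDisjTerm p g kp kn cp →
      IsThetaDisjTerm p (g ⊽ Term.id A) kp kn (Dir.l :: cp)

/-! ### The quotient of arrow terms by the equations -/

namespace PermLemma

variable {P : Type}

instance eqvSetoid (A B : Form P) : Setoid (Term P A B) :=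
  ⟨Eqv, Eqv.refl, Eqv.symm, Eqv.trans⟩

def Hm (A B : Form P) : Type := Quotient (eqvSetoid A B)

def q {A B : Form P} (f : Term P A B) : Hm A B := Quotient.mk _ f

def hc {A B C : Form P} (g : Hm B C) (f : Hm A B) : Hm A C :=
  Quotient.map₂ Term.comp (fun _ _ h _ _ h' => Eqv.congComp h h') g f

def hj {A B D E : Form P} (f : Hm A D) (g : Hm B E) : Hm (A ⋏ B) (D ⋏ E) :=
  Quotient.map₂ Term.conj (fun _ _ h _ _ h' => Eqv.congConj h h') f g

def hd {A B D E : Form P} (f : Hm A D) (g : Hm B E) : Hm (A ⋎ B) (D ⋎ E) :=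
  Quotient.map₂ Term.disj (fun _ _ h _ _ h' => Eqv.congDisj h h') f g

infixr:80 " ∙∙ " => hc
infixr:70 " ∧∧ " => hj
infixr:66 " ∨∨ " => hd

theorem q_comp {A B C : Form P} (g : Term P B C) (f : Term P A B) : q (g ⬝ f) = q g ∙∙ q f := rfl
theorem q_conj {A B D E : Form P} (f : Term P A D) (g : Term P B E) : q (f ⊼ g) = (q f ∧∧ q g) := rfl
theorem q_disj {A B D E : Form P} (f : Term P A D) (g : Term P B E) : q (f ⊽ g) = (q f ∨∨ q g) := rfl

theorem q_sound {A B : Form P} {f g : Term P A B} (h : Eqv f g) : q f = q g := Quotient.sound h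
theorem q_exact {A B : Form P} {f g : Term P A B} (h : q f = q g) : Eqv f g := Quotient.exact h

theorem q_surj {A B : Form P} (x : Hm A B) : ∃ f, q f = x := Quotient.exists_rep x

theorem idR {A B : Form P} (f : Hm A B) : f ∙∙ q (Term.id A) = f := by
  obtain ⟨f, rfl⟩ := q_surj f; exact q_sound (Eqv.catIdR f)
theorem idL {A B : Form P} (f : Hm A B) : q (Term.id B) ∙∙ f = f := by
  obtain ⟨f, rfl⟩ := q_surj f; exact q_sound (Eqv.catIdL f)
theorem assoc {A B C D : Form P} (h : Hm C D) (g : Hm B C) (f : Hm A B) :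
    (h ∙∙ g) ∙∙ f = h ∙∙ g ∙∙ f := by
  obtain ⟨f, rfl⟩ := q_surj f; obtain ⟨g, rfl⟩ := q_surj g; obtain ⟨h, rfl⟩ := q_surj h
  exact (q_sound (Eqv.catAssoc f g h)).symm
theorem conjId (A B : Form P) : (q (Term.id A) ∧∧ q (Term.id B)) = q (Term.id (A ⋏ B)) :=
  q_sound (Eqv.conjOne A B)
theorem disjId (A B : Form P) : (q (Term.id A) ∨∨ q (Term.id B)) = q (Term.id (A ⋎ B)) :=
  q_sound (Eqv.disjOne A B)
theorem conjComp {A₁ B₁ C₁ A₂ B₂ C₂ : Form P} (g₁ : Hm B₁ C₁) (f₁ : Hm A₁ B₁)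
    (g₂ : Hm B₂ C₂) (f₂ : Hm A₂ B₂) :
    (g₁ ∧∧ g₂) ∙∙ (f₁ ∧∧ f₂) = (g₁ ∙∙ f₁ ∧∧ g₂ ∙∙ f₂) := by
  obtain ⟨g₁, rfl⟩ := q_surj g₁; obtain ⟨g₂, rfl⟩ := q_surj g₂
  obtain ⟨f₁, rfl⟩ := q_surj f₁; obtain ⟨f₂, rfl⟩ := q_surj f₂
  exact (q_sound (Eqv.conjTwo g₁ f₁ g₂ f₂)).symm
theorem disjComp {A₁ B₁ C₁ A₂ B₂ C₂ : Form P} (g₁ : Hm B₁ C₁) (f₁ : Hm A₁ B₁)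
    (g₂ : Hm B₂ C₂) (f₂ : Hm A₂ B₂) :
    (g₁ ∨∨ g₂) ∙∙ (f₁ ∨∨ f₂) = (g₁ ∙∙ f₁ ∨∨ g₂ ∙∙ f₂) := by
  obtain ⟨g₁, rfl⟩ := q_surj g₁; obtain ⟨g₂, rfl⟩ := q_surj g₂
  obtain ⟨f₁, rfl⟩ := q_surj f₁; obtain ⟨f₂, rfl⟩ := q_surj f₂
  exact (q_sound (Eqv.disjTwo g₁ f₁ g₂ f₂)).symm
theorem cConjNat {A B D E : Form P} (f : Hm A D) (g : Hm B E) :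
    q (Term.cConj D E) ∙∙ (f ∧∧ g) = (g ∧∧ f) ∙∙ q (Term.cConj A B) := by
  obtain ⟨f, rfl⟩ := q_surj f; obtain ⟨g, rfl⟩ := q_surj g
  exact (q_sound (Eqv.cConjNat f g)).symm
theorem cDisjNat {A B D E : Form P} (f : Hm A D) (g : Hm B E) :
    q (Term.cDisj E D) ∙∙ (f ∨∨ g) = (g ∨∨ f) ∙∙ q (Term.cDisj B A) := by
  obtain ⟨f, rfl⟩ := q_surj f; obtain ⟨g, rfl⟩ := q_surj g
  exact (q_sound (Eqv.cDisjNat f g)).symm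
theorem dNat {A B C D E F : Form P} (f : Hm A D) (g : Hm B E) (h : Hm C F) :
    q (Term.d D E F) ∙∙ (f ∧∧ (g ∨∨ h)) = ((f ∧∧ g) ∨∨ h) ∙∙ q (Term.d A B C) := by
  obtain ⟨f, rfl⟩ := q_surj f; obtain ⟨g, rfl⟩ := q_surj g; obtain ⟨h, rfl⟩ := q_surj h
  exact (q_sound (Eqv.dNat f g h)).symm
theorem bToNat {A B C D E F : Form P} (f : Hm A D) (g : Hm B E) (h : Hm C F) :
    q (Term.bConjTo D E F) ∙∙ (f ∧∧ (g ∧∧ h)) = ((f ∧∧ g) ∧∧ h) ∙∙ q (Term.bConjTo A B C) := by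
  obtain ⟨f, rfl⟩ := q_surj f; obtain ⟨g, rfl⟩ := q_surj g; obtain ⟨h, rfl⟩ := q_surj h
  exact (q_sound (Eqv.bConjNat f g h)).symm
theorem dToNat {A B C D E F : Form P} (f : Hm A D) (g : Hm B E) (h : Hm C F) :
    q (Term.bDisjTo D E F) ∙∙ (f ∨∨ (g ∨∨ h)) = ((f ∨∨ g) ∨∨ h) ∙∙ q (Term.bDisjTo A B C) := by
  obtain ⟨f, rfl⟩ := q_surj f; obtain ⟨g, rfl⟩ := q_surj g; obtain ⟨h, rfl⟩ := q_surj h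
  exact (q_sound (Eqv.bDisjNat f g h)).symm
theorem bFT (A B C : Form P) : q (Term.bConjFrom A B C) ∙∙ q (Term.bConjTo A B C) = q (Term.id _) :=
  q_sound (Eqv.bConjIso₁ A B C)
theorem bTF (A B C : Form P) : q (Term.bConjTo A B C) ∙∙ q (Term.bConjFrom A B C) = q (Term.id _) :=
  q_sound (Eqv.bConjIso₂ A B C)
theorem dFT (A B C : Form P) : q (Term.bDisjFrom A B C) ∙∙ q (Term.bDisjTo A B C) = q (Term.id _) :=
  q_sound (Eqv.bDisjIso₁ A B C)
theorem dTF (A B C : Form P) : q (Term.bDisjTo A B C) ∙∙ q (Term.bDisjFrom A B C) = q (Term.id _) :=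
  q_sound (Eqv.bDisjIso₂ A B C)
theorem ccConj (A B : Form P) : q (Term.cConj B A) ∙∙ q (Term.cConj A B) = q (Term.id _) :=
  q_sound (Eqv.cConjIso A B)
theorem ccDisj (A B : Form P) : q (Term.cDisj A B) ∙∙ q (Term.cDisj B A) = q (Term.id _) :=
  q_sound (Eqv.cDisjIso A B)
theorem bFromNat {A B C D E F : Form P} (f : Hm A D) (g : Hm B E) (h : Hm C F) :
    q (Term.bConjFrom D E F) ∙∙ ((f ∧∧ g) ∧∧ h) = (f ∧∧ (g ∧∧ h)) ∙∙ q (Term.bConjFrom A B C) := by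
  have := bToNat f g h
  calc _ = q (Term.bConjFrom D E F) ∙∙ (((f ∧∧ g) ∧∧ h) ∙∙ q (Term.bConjTo A B C)) ∙∙
        q (Term.bConjFrom A B C) := by rw [assoc, bTF, idR]
    _ = _ := by rw [← this, assoc, ← assoc, bFT, idL]
theorem dFromNat {A B C D E F : Form P} (f : Hm A D) (g : Hm B E) (h : Hm C F) :
    q (Term.bDisjFrom D E F) ∙∙ ((f ∨∨ g) ∨∨ h) = (f ∨∨ (g ∨∨ h)) ∙∙ q (Term.bDisjFrom A B C) := by
  have := dToNat f g h
  calc _ = q (Term.bDisjFrom D E F) ∙∙ (((f ∨∨ g) ∨∨ h) ∙∙ q (Term.bDisjTo A B C)) ∙∙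
        q (Term.bDisjFrom A B C) := by rw [assoc, dTF, idR]
    _ = _ := by rw [← this, assoc, ← assoc, dFT, idL]

/-- From an equation through the inverse. -/
theorem bTo_of_bFrom {A B C X : Form P} {x : Hm X ((A ⋏ B) ⋏ C)} {y : Hm X (A ⋏ (B ⋏ C))}
    (h : q (Term.bConjFrom A B C) ∙∙ x = y) : q (Term.bConjTo A B C) ∙∙ y = x := by
  rw [← h, ← assoc, bTF, idL]

/-! ### Heads, uniformly in the orientation of the crown -/

def lit (p : P) : Bool → Form P
  | true => Form.pos p
  | false => Form.natom p

def HR (p : P) : ∀ (b : Bool) (A : Form P), Term P A (A ⋏ (lit p (!b) ⋎ lit p b))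
  | true, A => Term.delta p A
  | false, A => delta' p A

def HL (p : P) : ∀ (b : Bool) (A : Form P), Term P A ((lit p (!b) ⋎ lit p b) ⋏ A)
  | true, A => sigmaConj p A
  | false, A => sigmaConj' p A

def pb : Bool → ℕ
  | true => 1
  | false => 0

def nb : Bool → ℕ
  | true => 0
  | false => 1

inductive Xi (p : P) : ∀ {A B : Form P}, Term P A B → ℕ → ℕ → List Dir → Prop
  | hr (b : Bool) (B : Form P) : Xi p (HR p b B) (B.size + pb b) (B.size + nb b) [Dir.r]
  | hl (b : Bool) (B : Form P) : Xi p (HL p b B) (pb b) (nb b) [Dir.l]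
  | conjL (A : Form P) {C D : Form P} {g : Term P C D} {kp kn : ℕ} {cp : List Dir} :
      Xi p g kp kn cp → Xi p (Term.id A ⊼ g) (A.size + kp) (A.size + kn) (Dir.r :: cp)
  | conjR (A : Form P) {C D : Form P} {g : Term P C D} {kp kn : ℕ} {cp : List Dir} :
      Xi p g kp kn cp → Xi p (g ⊼ Term.id A) kp kn (Dir.l :: cp)
  | disjL (A : Form P) {C D : Form P} {g : Term P C D} {kp kn : ℕ} {cp : List Dir} :
      Xi p g kp kn cp → Xi p (Term.id A ⊽ g) (A.size + kp) (A.size + kn) (Dir.r :: cp)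
  | disjR (A : Form P) {C D : Form P} {g : Term P C D} {kp kn : ℕ} {cp : List Dir} :
      Xi p g kp kn cp → Xi p (g ⊽ Term.id A) kp kn (Dir.l :: cp)

theorem xi_of {p : P} {A B : Form P} {g : Term P A B} {kp kn : ℕ} {cp : List Dir}
    (h : IsXiConjTerm p g kp kn cp) : Xi p g kp kn cp := by
  induction h with
  | delta B => exact Xi.hr true B
  | delta' B => exact Xi.hr false B
  | sigmaConj B => exact Xi.hl true B
  | sigmaConj' B => exact Xi.hl false B
  | conjL A _ ih => exact ih.conjL A
  | conjR A _ ih => exact ih.conjR A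
  | disjL A _ ih => exact ih.disjL A
  | disjR A _ ih => exact ih.disjR A

theorem of_xi {p : P} {A B : Form P} {g : Term P A B} {kp kn : ℕ} {cp : List Dir}
    (h : Xi p g kp kn cp) : IsXiConjTerm p g kp kn cp := by
  induction h with
  | hr b B =>
    cases b
    · exact IsXiConjTerm.delta' B
    · exact IsXiConjTerm.delta B
  | hl b B =>
    cases b
    · exact IsXiConjTerm.sigmaConj' B
    · exact IsXiConjTerm.sigmaConj B
  | conjL A _ ih => exact ih.conjL A
  | conjR A _ ih => exact ih.conjR A
  | disjL A _ ih => exact ih.disjL A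
  | disjR A _ ih => exact ih.disjR A

theorem HR_nat (p : P) (b : Bool) {A D : Form P} (f : Hm A D) :
    (f ∧∧ q (Term.id _)) ∙∙ q (HR p b A) = q (HR p b D) ∙∙ f := by
  obtain ⟨f, rfl⟩ := q_surj f
  have h := q_sound (Eqv.deltaNat p f)
  cases b
  · change (q f ∧∧ q (Term.id _)) ∙∙ (q (Term.id _) ∧∧ q (Term.cDisj _ _)) ∙∙ q (Term.delta p A) =
      ((q (Term.id _) ∧∧ q (Term.cDisj _ _)) ∙∙ q (Term.delta p D)) ∙∙ q f
    rw [q_comp, q_comp, q_conj] at h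
    rw [assoc, ← h, ← assoc, ← assoc, conjComp, conjComp, idL, idL, idR, idR]
  · exact h

theorem HL_eq (p : P) (b : Bool) (A : Form P) :
    q (HL p b A) = q (Term.cConj A _) ∙∙ q (HR p b A) := by
  cases b <;> rfl

theorem HR_eq (p : P) (b : Bool) (A : Form P) :
    q (HR p b A) = q (Term.cConj _ A) ∙∙ q (HL p b A) := by
  rw [HL_eq, ← assoc, ccConj, idL]

theorem HL_nat (p : P) (b : Bool) {A D : Form P} (f : Hm A D) :
    (q (Term.id _) ∧∧ f) ∙∙ q (HL p b A) = q (HL p b D) ∙∙ f := by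
  rw [HL_eq, HL_eq, assoc, ← HR_nat, ← assoc, ← assoc, cConjNat]

theorem HR_b (p : P) (b : Bool) (A B : Form P) :
    q (Term.bConjFrom A B _) ∙∙ q (HR p b (A ⋏ B)) = (q (Term.id A) ∧∧ q (HR p b B)) := by
  have h := q_sound (Eqv.bDelta A B p)
  cases b
  · change q (Term.bConjFrom A B _) ∙∙ (q (Term.id _) ∧∧ q (Term.cDisj _ _)) ∙∙ q (Term.delta p _) =
      (q (Term.id _) ∧∧ ((q (Term.id _) ∧∧ q (Term.cDisj _ _)) ∙∙ q (Term.delta p B)))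
    rw [q_comp, q_conj] at h
    rw [← assoc, ← conjId, bFromNat, assoc, h, conjComp, idL]
  · exact h

theorem hexa (A B C : Form P) :
    (q (Term.id B) ∧∧ q (Term.cConj C A)) ∙∙ q (Term.bConjFrom B C A) ∙∙
            q (Term.cConj A (B ⋏ C)) ∙∙ q (Term.bConjFrom A B C) ∙∙
            (q (Term.cConj B A) ∧∧ q (Term.id C)) =
        q (Term.bConjFrom B A C) := q_sound (Eqv.bcConj A B C)

theorem cancelL {A B C : Form P} {i : Hm B C} (j : Hm C B) (h : j ∙∙ i = q (Term.id _))
    {x y : Hm A B} (e : i ∙∙ x = i ∙∙ y) : x = y := by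
  rw [← idL x, ← idL y, ← h, assoc, assoc, e]

/-- Triangle. -/
theorem tri (p : P) (b : Bool) (A C : Form P) :
    q (Term.bConjFrom A _ C) ∙∙ (q (HR p b A) ∧∧ q (Term.id C)) =
      (q (Term.id A) ∧∧ q (HL p b C)) := by
  have e1 : (q (HR p b A) ∧∧ q (Term.id C)) =
      q (Term.cConj C _) ∙∙ q (Term.bConjFrom C A _) ∙∙ (q (Term.cConj A C) ∧∧ q (Term.id _)) ∙∙
        q (HR p b (A ⋏ C)) := by
    rw [HR_nat, ← assoc (q (Term.bConjFrom C A _)), HR_b, ← assoc, cConjNat, assoc, ccConj, idR]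
  have h := hexa C A (lit p (!b) ⋎ lit p b)
  apply cancelL (i := (q (Term.id A) ∧∧ q (Term.cConj _ C)))
    (q (Term.id A) ∧∧ q (Term.cConj C _))
  · rw [conjComp, ccConj, idL, conjId]
  rw [e1, conjComp, ← HR_eq, idL, ← HR_b, ← h]
  simp only [assoc]

theorem HL_b (p : P) (b : Bool) (A C : Form P) :
    q (Term.bConjFrom _ A C) ∙∙ (q (HL p b A) ∧∧ q (Term.id C)) = q (HL p b (A ⋏ C)) := by
  have h := hexa (lit p (!b) ⋎ lit p b) A C
  have t := tri p b A C
  rw [← h] at t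
  simp only [assoc, conjComp, idL, ← HL_eq] at t
  have e : (q (Term.id A) ∧∧ q (HL p b C)) = (q (Term.id A) ∧∧ q (Term.cConj C _)) ∙∙
      q (Term.bConjFrom A C _) ∙∙ q (Term.cConj _ (A ⋏ C)) ∙∙ q (HL p b (A ⋏ C)) := by
    rw [← HR_eq, HR_b, conjComp, idL, ← HL_eq]
  rw [e] at t
  refine cancelL (q (Term.cConj _ _)) (ccConj _ _) (cancelL _ (bTF _ _ _) ?_)
  refine cancelL (q (Term.id A) ∧∧ q (Term.cConj _ C)) ?_ t
  rw [conjComp, ccConj, idL, conjId]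

theorem HL_false (p : P) (A : Form P) :
    q (HL p false A) = (q (Term.cDisj _ _) ∧∧ q (Term.id A)) ∙∙ q (HL p true A) := by
  rw [HL_eq, HL_eq, ← assoc, ← cConjNat, assoc]; rfl

theorem HL_d (p : P) (b : Bool) (B C : Form P) :
    q (Term.d _ B C) ∙∙ q (HL p b (B ⋎ C)) = (q (HL p b B) ∨∨ q (Term.id C)) := by
  have h : q (Term.d _ B C) ∙∙ q (HL p true (B ⋎ C)) = (q (HL p true B) ∨∨ q (Term.id C)) :=
    q_sound (Eqv.dSigmaConj p B C)
  cases b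
  · rw [HL_false, HL_false, ← disjId, ← assoc, dNat, assoc, h, disjComp, idL]
  · exact h

theorem HR_swap_true (p : P) (A : Form P) :
    (q (Term.id A) ∧∧ q (Term.cDisj (lit p true) (lit p false))) ∙∙ q (HR p true A) =
      q (HR p false A) := rfl

theorem HR_swap_false (p : P) (A : Form P) :
    (q (Term.id A) ∧∧ q (Term.cDisj (lit p false) (lit p true))) ∙∙ q (HR p false A) =
      q (HR p true A) := by
  change (q (Term.id A) ∧∧ q (Term.cDisj _ _)) ∙∙
    (q (Term.id _) ∧∧ q (Term.cDisj _ _)) ∙∙ q (Term.delta p A) = q (Term.delta p A)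
  rw [← assoc, conjComp, idL, ccDisj, conjId, idL]

theorem HL_swap_true (p : P) (A : Form P) :
    (q (Term.cDisj (lit p true) (lit p false)) ∧∧ q (Term.id A)) ∙∙ q (HL p true A) =
      q (HL p false A) := (HL_false p A).symm

theorem HL_swap_false (p : P) (A : Form P) :
    (q (Term.cDisj (lit p false) (lit p true)) ∧∧ q (Term.id A)) ∙∙ q (HL p false A) =
      q (HL p true A) := by
  rw [HL_false, ← assoc]
  change ((q (Term.cDisj _ _) ∧∧ q (Term.id _)) ∙∙ (q (Term.cDisj _ _) ∧∧ q (Term.id A))) ∙∙ _ = _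
  rw [conjComp, idL, ccDisj, conjId, idL]

/-! ### Permutations of letter occurrences -/

def ph : ∀ {A B : Form P}, Term P A B → ℕ → ℕ
  | _, _, .id _, n => n
  | _, _, .comp g f, n => ph g (ph f n)
  | _, _, @Term.conj _ A _ D _ f g, n => if n < A.size then ph f n else D.size + ph g (n - A.size)
  | _, _, @Term.disj _ A _ D _ f g, n => if n < A.size then ph f n else D.size + ph g (n - A.size)
  | _, _, .bConjTo _ _ _, n => n
  | _, _, .bConjFrom _ _ _, n => n
  | _, _, .bDisjTo _ _ _, n => n
  | _, _, .bDisjFrom _ _ _, n => n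
  | _, _, .cConj A B, n => if n < A.size then n + B.size else n - A.size
  | _, _, .cDisj A B, n => if n < B.size then n + A.size else n - B.size
  | _, _, .d _ _ _, n => n
  | _, _, .delta _ _, n => n
  | _, _, .sigma _ _, n => n

theorem size_pos (A : Form P) : 0 < A.size := by
  induction A <;> simp only [Form.size] <;> omega

theorem size_eq {A B : Form P} (f : Term P A B) (h : IsDSTerm f) : A.size = B.size := by
  induction f <;> simp only [IsDSTerm, Form.size] at * <;> grind

theorem ph_lt {A B : Form P} (f : Term P A B) (h : IsDSTerm f) :
    ∀ n, n < A.size → ph f n < B.size := by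
  induction f with
  | comp g f ihg ihf => intro n hn; exact ihg h.1 _ (ihf h.2 _ hn)
  | @conj A B D E f g ihf ihg =>
    intro n hn
    have h1 := ihf h.1 n
    have h2 := ihg h.2 (n - A.size)
    simp only [Form.size, ph] at *
    split_ifs <;> omega
  | @disj A B D E f g ihf ihg =>
    intro n hn
    have h1 := ihf h.1 n
    have h2 := ihg h.2 (n - A.size)
    simp only [Form.size, ph] at *
    split_ifs <;> omega
  | delta => exact h.elim
  | sigma => exact h.elim
  | _ => intro n hn; simp only [Form.size, ph] at *; first | omega | (split_ifs <;> omega)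

/-- Invariant of linking. -/
def Nm (φ : ℕ → ℕ) : ℕ ⊕ ℕ → ℕ
  | .inl i => φ i
  | .inr j => j

theorem G_bd {A B : Form P} (f : Term P A B) (h : IsDSTerm f) :
    ∀ u v, Term.G f u v →
      (∀ i, u = Sum.inl i → i < A.size) ∧ (∀ i, v = Sum.inl i → i < A.size) := by
  induction f with
  | comp g f ihg ihf =>
    intro u v huv
    constructor
    · rintro i rfl
      obtain ⟨c, hc, -⟩ := Relation.TransGen.head'_iff.1 huv
      rcases hc with ⟨x, y, hx, -, hr⟩ | ⟨x, y, hx, -, -⟩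
      · cases x <;> simp at hx
        subst hx
        exact (ihf h.2 _ _ hr).1 _ rfl
      · simp at hx
    · rintro i rfl
      obtain ⟨c, -, hc⟩ := Relation.TransGen.tail'_iff.1 huv
      rcases hc with ⟨x, y, -, hx, hr⟩ | ⟨x, y, -, hx, -⟩
      · cases y <;> simp at hx
        subst hx
        exact (ihf h.2 _ _ hr).2 _ rfl
      · simp at hx
  | conj f g ihf ihg =>
    intro u v huv
    simp only [Form.size]
    rcases huv with huv | ⟨u', v', huv, rfl, rfl⟩
    · have := ihf h.1 _ _ huv
      exact ⟨fun i hi => by have := this.1 i hi; omega, fun i hi => by have := this.2 i hi; omega⟩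
    · have := ihg h.2 _ _ huv
      constructor
      · intro i hi
        cases u' <;> simp at hi
        have := this.1 _ rfl
        omega
      · intro i hi
        cases v' <;> simp at hi
        have := this.2 _ rfl
        omega
  | disj f g ihf ihg =>
    intro u v huv
    simp only [Form.size]
    rcases huv with huv | ⟨u', v', huv, rfl, rfl⟩
    · have := ihf h.1 _ _ huv
      exact ⟨fun i hi => by have := this.1 i hi; omega, fun i hi => by have := this.2 i hi; omega⟩
    · have := ihg h.2 _ _ huv
      constructor
      · intro i hi
        cases u' <;> simp at hi
        have := this.1 _ rfl
        omega
      · intro i hi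
        cases v' <;> simp at hi
        have := this.2 _ rfl
        omega
  | delta => exact h.elim
  | sigma => exact h.elim
  | _ =>
    rintro u v ⟨i, hi, hu, hv⟩
    try simp only [Form.size]
    constructor
    · rintro j rfl; simp at hu; omega
    · rintro j rfl; simp at hv; omega

theorem par_nm {A D : Form P} {R S : GRel} {φ ψ : ℕ → ℕ}
    (hR : ∀ u v, R u v → Nm φ u = Nm φ v)
    (hb : ∀ u v, R u v → (∀ i, u = Sum.inl i → i < A.size) ∧ (∀ i, v = Sum.inl i → i < A.size))
    (hS : ∀ u v, S u v → Nm ψ u = Nm ψ v) (u v) (h : gPar A.size D.size R S u v) :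
    Nm (fun n => if n < A.size then φ n else D.size + ψ (n - A.size)) u =
    Nm (fun n => if n < A.size then φ n else D.size + ψ (n - A.size)) v := by
  rcases h with h | ⟨u', v', h, rfl, rfl⟩
  · have h1 := hb _ _ h
    have h2 := hR _ _ h
    rcases u with u | u <;> rcases v with v | v <;> simp [Nm] at * <;> simp_all
  · have h2 := hS _ _ h
    rcases u' with u | u <;> rcases v' with v | v <;> simp [Nm] at * <;> omega

theorem G_nm {A B : Form P} (f : Term P A B) (h : IsDSTerm f) :
    ∀ u v, Term.G f u v → Nm (ph f) u = Nm (ph f) v := by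
  induction f with
  | comp g f ihg ihf =>
    intro u v huv
    let K : ℕ ⊕ ℕ ⊕ ℕ → ℕ := fun x => match x with
      | .inl i => ph g (ph f i)
      | .inr (.inl j) => ph g j
      | .inr (.inr k) => k
    have key : ∀ x y, Relation.TransGen
        (fun x y : ℕ ⊕ ℕ ⊕ ℕ =>
          (∃ x' y', Sum.map id Sum.inl x' = x ∧ Sum.map id Sum.inl y' = y ∧ Term.G f x' y') ∨
          (∃ x' y', Sum.inr x' = x ∧ Sum.inr y' = y ∧ Term.G g x' y')) x y → K x = K y := by
      have step : ∀ x y, ((∃ x' y', Sum.map id Sum.inl x' = x ∧ Sum.map id Sum.inl y' = y ∧ Term.G f x' y') ∨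
          (∃ x' y', Sum.inr x' = x ∧ Sum.inr y' = y ∧ Term.G g x' y')) → K x = K y := by
        rintro x y (⟨x', y', rfl, rfl, hr⟩ | ⟨x', y', rfl, rfl, hr⟩)
        · have := congrArg (ph g) (ihf h.2 _ _ hr)
          cases x' <;> cases y' <;> exact this
        · have := ihg h.1 _ _ hr
          cases x' <;> cases y' <;> exact this
      intro x y hxy
      induction hxy with
      | single hs => exact step _ _ hs
      | tail _ hs ih => exact ih.trans (step _ _ hs)
    have := key _ _ huv
    cases u <;> cases v <;> exact this
  | conj f g ihf ihg =>
    intro u v huv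
    exact par_nm (ihf h.1) (G_bd f h.1) (ihg h.2) u v huv
  | disj f g ihf ihg =>
    intro u v huv
    exact par_nm (ihf h.1) (G_bd f h.1) (ihg h.2) u v huv
  | delta => exact h.elim
  | sigma => exact h.elim
  | _ => rintro u v ⟨i, hi, rfl | rfl, rfl | rfl⟩ <;> rfl

theorem linked_ph {A B : Form P} (f : Term P A B) (h : IsDSTerm f) {n m : ℕ}
    (hl : Linked f n m) : m = ph f n := (G_nm f h _ _ hl).symm

/-! ### Letters that are conjuncts -/

def CP : Form P → ℕ → Prop
  | .pos _, _ => False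
  | .natom _, _ => False
  | .conj A B, n => if n < A.size then A.size = 1 ∨ CP A n else B.size = 1 ∨ CP B (n - A.size)
  | .disj A B, n => if n < A.size then CP A n else CP B (n - A.size)

theorem CP_pres {A B : Form P} (f : Term P A B) (h : IsDSTerm f) :
    ∀ n, n < A.size → CP A n → CP B (ph f n) := by
  induction f with
  | id => intro n _ hn; exact hn
  | comp g f ihg ihf => intro n hn hc; exact ihg h.1 _ (ph_lt f h.2 _ hn) (ihf h.2 _ hn hc)
  | @conj A B D E f g ihf ihg =>
    intro n hn hc
    have h1 := ihf h.1 n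
    have h2 := ihg h.2 (n - A.size)
    have h3 := size_eq f h.1
    have h4 := size_eq g h.2
    have h5 := ph_lt f h.1 n
    simp only [Form.size, ph, CP] at *
    grind
  | @disj A B D E f g ihf ihg =>
    intro n hn hc
    have h1 := ihf h.1 n
    have h2 := ihg h.2 (n - A.size)
    have h3 := size_eq f h.1
    have h4 := size_eq g h.2
    have h5 := ph_lt f h.1 n
    simp only [Form.size, ph, CP] at *
    grind
  | delta => exact h.elim
  | sigma => exact h.elim
  | bConjTo A B C =>
    intro n hn hc
    have := size_pos A; have := size_pos B; have := size_pos C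
    simp only [Form.size, ph, CP, ← Nat.sub_sub] at *
    grind
  | bConjFrom A B C =>
    intro n hn hc
    have := size_pos A; have := size_pos B; have := size_pos C
    simp only [Form.size, ph, CP, ← Nat.sub_sub] at *
    grind
  | bDisjTo A B C =>
    intro n hn hc
    simp only [Form.size, ph, CP, ← Nat.sub_sub] at *
    grind
  | bDisjFrom A B C =>
    intro n hn hc
    simp only [Form.size, ph, CP, ← Nat.sub_sub] at *
    grind
  | cConj A B =>
    intro n hn hc
    simp only [Form.size, ph, CP] at *
    grind
  | cDisj A B =>
    intro n hn hc
    simp only [Form.size, ph, CP] at *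
    grind
  | d A B C =>
    intro n hn hc
    have := size_pos A; have := size_pos B; have := size_pos C
    simp only [Form.size, ph, CP, ← Nat.sub_sub] at *
    grind

theorem sub_size {E F : Form P} {ρ : List Dir} (h : E.subAt ρ = some F) :
    E.offsetAt ρ + F.size ≤ E.size := by
  induction E generalizing ρ with
  | pos a => cases ρ <;> simp [Form.subAt, Form.offsetAt] at *; subst h; rfl
  | natom a => cases ρ <;> simp [Form.subAt, Form.offsetAt] at *; subst h; rfl
  | conj A B ihA ihB =>
    rcases ρ with _ | ⟨_ | _, ρ⟩ <;> simp only [Form.subAt, Form.offsetAt, Form.size] at *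
    · cases h; simp [Form.size]
    · have := ihA h; omega
    · have := ihB h; omega
  | disj A B ihA ihB =>
    rcases ρ with _ | ⟨_ | _, ρ⟩ <;> simp only [Form.subAt, Form.offsetAt, Form.size] at *
    · cases h; simp [Form.size]
    · have := ihA h; omega
    · have := ihB h; omega

theorem not_CP {E a b : Form P} {ρ : List Dir} (h : E.subAt ρ = some (a ⋎ b))
    (ha : ∀ n, ¬ CP a n) (hb : ∀ n, ¬ CP b n) (n : ℕ) (h1 : E.offsetAt ρ ≤ n)
    (h2 : n < E.offsetAt ρ + (a.size + b.size)) : ¬ CP E n := by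
  have := size_pos a
  have := size_pos b
  induction E generalizing ρ n with
  | pos => simp [CP]
  | natom => simp [CP]
  | conj A B ihA ihB =>
    rcases ρ with _ | ⟨_ | _, ρ⟩ <;> simp only [Form.subAt, Form.offsetAt] at h h1 h2
    · cases h
    · have h3 := ihA h n h1 h2
      have := sub_size h
      simp only [Form.size, CP] at *
      grind
    · have h3 := ihB h (n - A.size) (by omega) (by omega)
      have := sub_size h
      simp only [Form.size, CP] at *
      grind
  | disj A B ihA ihB =>
    rcases ρ with _ | ⟨_ | _, ρ⟩ <;> simp only [Form.subAt, Form.offsetAt] at h h1 h2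
    · cases h
      simp only [CP]
      split_ifs
      · exact ha _
      · exact hb _
    · have h3 := ihA h n h1 h2
      have := sub_size h
      simp only [Form.size, CP] at *
      grind
    · have h3 := ihB h (n - A.size) (by omega) (by omega)
      have := sub_size h
      simp only [Form.size, CP] at *
      grind

/-- Subformula occurrences of the form `a ∨ b` with `a`, `b` of size 1 are determined by
their offset. -/
theorem path_unique {E a b a' b' : Form P} {ρ σ : List Dir} (h : E.subAt ρ = some (a ⋎ b))
    (h' : E.subAt σ = some (a' ⋎ b')) (ha : a.size = 1) (hb : b.size = 1)
    (ha' : a'.size = 1) (hb' : b'.size = 1)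
    (ho : E.offsetAt ρ = E.offsetAt σ) : ρ = σ := by
  induction E generalizing ρ σ with
  | pos => cases ρ <;> simp [Form.subAt] at h
  | natom => cases ρ <;> simp [Form.subAt] at h
  | conj A B ihA ihB =>
    have := size_pos A; have := size_pos B
    rcases ρ with _ | ⟨_ | _, ρ⟩ <;> rcases σ with _ | ⟨_ | _, σ⟩ <;>
      simp only [Form.subAt, Form.offsetAt] at * <;> try contradiction
    all_goals try (simp only [Option.some.injEq, reduceCtorEq] at *)
    · rw [ihA h h' ho]
    · have := sub_size h; simp only [Form.size] at this; omega
    · have := sub_size h'; simp only [Form.size] at this; omega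
    · rw [ihB h h' (by omega)]
  | disj A B ihA ihB =>
    have := size_pos A; have := size_pos B
    rcases ρ with _ | ⟨_ | _, ρ⟩ <;> rcases σ with _ | ⟨_ | _, σ⟩ <;>
      simp only [Form.subAt, Form.offsetAt] at *
    · cases h; have := sub_size h'; simp only [Form.size] at this; omega
    · cases h; have := sub_size h'; simp only [Form.size] at this; omega
    · cases h'; have := sub_size h; simp only [Form.size] at this; omega
    · rw [ihA h h' ho]
    · have := sub_size h; simp only [Form.size] at this; omega
    · cases h'; have := sub_size h; simp only [Form.size] at this; omega
    · have := sub_size h'; simp only [Form.size] at this; omega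
    · rw [ihB h h' (by omega)]

theorem lit_size (p : P) (b : Bool) : (lit p b).size = 1 := by cases b <;> rfl

theorem xi_sub {p : P} {A B : Form P} {g : Term P A B} {kp kn : ℕ} {cp : List Dir}
    (h : Xi p g kp kn cp) : ∃ b, B.subAt cp = some (lit p (!b) ⋎ lit p b) ∧
      kp = B.offsetAt cp + pb b ∧ kn = B.offsetAt cp + nb b := by
  induction h with
  | hr b B => exact ⟨b, by simp [Form.subAt, Form.offsetAt]⟩
  | hl b B => exact ⟨b, by simp [Form.subAt, Form.offsetAt]⟩
  | conjL A _ ih => obtain ⟨b, h1, h2, h3⟩ := ih; exact ⟨b, h1, by simp [Form.offsetAt]; omega⟩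
  | conjR A _ ih => obtain ⟨b, h1, h2, h3⟩ := ih; exact ⟨b, h1, by simp [Form.offsetAt]; omega⟩
  | disjL A _ ih => obtain ⟨b, h1, h2, h3⟩ := ih; exact ⟨b, h1, by simp [Form.offsetAt]; omega⟩
  | disjR A _ ih => obtain ⟨b, h1, h2, h3⟩ := ih; exact ⟨b, h1, by simp [Form.offsetAt]; omega⟩

theorem xi_lt {p : P} {A B : Form P} {g : Term P A B} {kp kn : ℕ} {cp : List Dir}
    (h : Xi p g kp kn cp) : kp < B.size ∧ kn < B.size := by
  obtain ⟨b, h1, h2, h3⟩ := xi_sub h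
  have := sub_size h1
  simp only [Form.size, lit_size] at this
  cases b <;> simp only [pb, nb] at * <;> omega

/-! ### DS terms from very small formulae -/

inductive Lf : ∀ {A B : Form P}, Hm A B → Prop
  | id (A : Form P) : Lf (q (Term.id A))

theorem leaf_id {A B : Form P} (f : Term P A B) (h : IsDSTerm f) (hA : A.size = 1) :
    Lf (q f) := by
  induction f with
  | id A => exact Lf.id A
  | comp g f ihg ihf =>
    have hf := ihf h.2 hA
    have hg := ihg h.1 (by rw [← size_eq f h.2]; exact hA)
    rw [q_comp]
    generalize q f = x at *
    generalize q g = y at *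
    cases hf
    rw [idR]; exact hg
  | delta => exact h.elim
  | sigma => exact h.elim
  | @conj A B _ _ _ _ =>
    have := size_pos A; have := size_pos B; simp only [Form.size] at hA; omega
  | @disj A B _ _ _ _ =>
    have := size_pos A; have := size_pos B; simp only [Form.size] at hA; omega
  | cConj A B => have := size_pos A; have := size_pos B; simp only [Form.size] at hA; omega
  | cDisj A B => have := size_pos A; have := size_pos B; simp only [Form.size] at hA; omega
  | _ A B C =>
    have := size_pos A; have := size_pos B; have := size_pos C; simp only [Form.size] at hA; omega

inductive Sw (a b : Form P) : ∀ {B : Form P}, Hm (a ⋎ b) B → ℕ → ℕ → Prop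
  | id : Sw a b (q (Term.id (a ⋎ b))) 0 1
  | sw : Sw a b (q (Term.cDisj b a)) 1 0

theorem two_sw {A B : Form P} (f : Term P A B) (h : IsDSTerm f) (a b : Form P)
    (hA : A = a ⋎ b) (ha : a.size = 1) (hb : b.size = 1) :
    Sw a b (q (hA ▸ f)) (ph f 0) (ph f 1) := by
  induction f generalizing a b with
  | id A => subst hA; exact Sw.id
  | comp g f ihg ihf =>
    subst hA
    have hf := ihf h.2 a b rfl ha hb
    change Sw a b (q g ∙∙ q f) (ph g (ph f 0)) (ph g (ph f 1))
    change Sw a b (q f) _ _ at hf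
    generalize q f = x at *
    generalize ph f 0 = n at *
    generalize ph f 1 = m at *
    cases hf with
    | id => rw [idR]; exact ihg h.1 a b rfl ha hb
    | sw =>
      have hg := ihg h.1 b a rfl hb ha
      change Sw b a (q g) _ _ at hg
      generalize q g = x at *
      generalize ph g 0 = n at *
      generalize ph g 1 = m at *
      cases hg with
      | id => rw [idL]; exact Sw.sw
      | sw => rw [ccDisj]; exact Sw.id
  | delta => exact h.elim
  | sigma => exact h.elim
  | @disj A B D E f g =>
    cases hA
    have hf := leaf_id f h.1 ha
    have hg := leaf_id g h.2 hb
    have e1 := ph_lt f h.1 0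
    have e2 := ph_lt g h.2 0
    have e3 := size_eq f h.1
    have e4 := size_eq g h.2
    change Sw A B (q f ∨∨ q g) _ _
    have e5 : ph (f ⊽ g) 0 = 0 := by simp only [ph]; rw [if_pos (by omega)]; omega
    have e6 : ph (f ⊽ g) 1 = 1 := by
      simp only [ph]; rw [if_neg (by omega), ha, Nat.sub_self]; omega
    rw [e5, e6]
    clear e1 e2 e3 e4 e5 e6
    generalize q f = x at *
    generalize q g = y at *
    cases hf; cases hg
    rw [disjId]; exact Sw.id
  | cDisj A B =>
    cases hA
    have e5 : ph (Term.cDisj A B) 0 = 1 := by simp [ph, ha, hb]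
    have e6 : ph (Term.cDisj A B) 1 = 0 := by simp [ph, ha]
    rw [e5, e6]; exact Sw.sw
  | bDisjTo A B C =>
    cases hA
    have := size_pos B; have := size_pos C; simp only [Form.size] at hb; omega
  | bDisjFrom A B C =>
    cases hA
    have := size_pos B; have := size_pos A; simp only [Form.size] at ha; omega
  | conj => cases hA
  | cConj => cases hA
  | bConjTo => cases hA
  | bConjFrom => cases hA
  | d => cases hA

/-! ### The main induction -/

def Good (p : P) {C D E : Form P} (f : Term P D E) (g : Term P C D) (kp kn : ℕ) : Prop :=
  (∃ (D' : Form P) (g' : Term P D' E) (f' : Term P C D') (cp : List Dir),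
    Xi p g' (ph f kp) (ph f kn) cp ∧ IsDSTerm f' ∧ q f ∙∙ q g = q g' ∙∙ q f') ∨
  (CP E (ph f kp) ∨ CP E (ph f kn))

theorem Good.mk {p : P} {C D E D' : Form P} {f : Term P D E} {g : Term P C D} {kp kn k1 k2 : ℕ}
    {g' : Term P D' E} {cp : List Dir} (f' : Term P C D') (h : Xi p g' k1 k2 cp)
    (hf : IsDSTerm f') (e : q f ∙∙ q g = q g' ∙∙ q f') (e1 : k1 = ph f kp) (e2 : k2 = ph f kn) :
    Good p f g kp kn := by
  subst e1 e2
  exact Or.inl ⟨_, _, _, _, h, hf, e⟩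

/-- When the composite is itself a `Xi`-term. -/
theorem Good.mk1 {p : P} {C D E : Form P} {f : Term P D E} {g : Term P C D} {kp kn k1 k2 : ℕ}
    {g' : Term P C E} {cp : List Dir} (h : Xi p g' k1 k2 cp)
    (e : q f ∙∙ q g = q g') (e1 : k1 = ph f kp) (e2 : k2 = ph f kn) :
    Good p f g kp kn :=
  Good.mk (Term.id _) h trivial (by rw [e, idR]) e1 e2

theorem pb_lt (b : Bool) : pb b < 2 := by cases b <;> simp [pb]
theorem nb_lt (b : Bool) : nb b < 2 := by cases b <;> simp [nb]

theorem good_conj {p : P} {A B D E : Form P} (f₁ : Term P A D) (f₂ : Term P B E)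
    (h₁ : IsDSTerm f₁) (h₂ : IsDSTerm f₂)
    (ih₁ : ∀ {C : Form P} (g : Term P C A) (kp kn : ℕ) (cp : List Dir), Xi p g kp kn cp →
      Good p f₁ g kp kn)
    (ih₂ : ∀ {C : Form P} (g : Term P C B) (kp kn : ℕ) (cp : List Dir), Xi p g kp kn cp →
      Good p f₂ g kp kn)
    {C : Form P} (g : Term P C (A ⋏ B)) (kp kn : ℕ) (cp : List Dir) (hg : Xi p g kp kn cp) :
    Good p (f₁ ⊼ f₂) g kp kn := by
  have s1 := size_eq f₁ h₁
  cases hg with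
  | hr b =>
    have hs := two_sw f₂ h₂ _ _ rfl (lit_size p _) (lit_size p _)
    change Sw _ _ (q f₂) _ _ at hs
    have e0 : ∀ k, ph (f₁ ⊼ f₂) (A.size + k) = D.size + ph f₂ k := by
      intro k; simp only [ph]; rw [if_neg (by omega), Nat.add_sub_cancel_left]
    have key : ∀ (b' : Bool) (f2 : Hm _ (lit p (!b') ⋎ lit p b')) ,
        (q (Term.id D) ∧∧ f2) ∙∙ q (HR p b D) = q (HR p b' D) →
        (q f₁ ∧∧ f2) ∙∙ q (HR p b A) = q (HR p b' D) ∙∙ q f₁ := by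
      intro b' f2 hb
      rw [← hb, assoc, ← HR_nat, ← assoc, conjComp, idL, idR]
    generalize hx : q f₂ = x at hs
    generalize hn : ph f₂ 0 = n at hs
    generalize hm : ph f₂ 1 = m at hs
    cases hs with
    | id =>
      refine Good.mk f₁ (Xi.hr b D) h₁ ?_ ?_ ?_
      · rw [q_conj, hx]
        exact key b _ (by rw [conjId, idL])
      · rw [e0]; cases b <;> simp [pb, hn, hm]
      · rw [e0]; cases b <;> simp [nb, hn, hm]
    | sw =>
      cases b with
      | true =>
        refine Good.mk f₁ (Xi.hr false D) h₁ ?_ ?_ ?_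
        · rw [q_conj, hx]
          exact key false _ (HR_swap_true p D)
        · rw [e0]; simp [pb, hn, hm]
        · rw [e0]; simp [nb, hn, hm]
      | false =>
        refine Good.mk f₁ (Xi.hr true D) h₁ ?_ ?_ ?_
        · rw [q_conj, hx]
          exact key true _ (HR_swap_false p D)
        · rw [e0]; simp [pb, hn, hm]
        · rw [e0]; simp [nb, hn, hm]
  | hl b =>
    have hs := two_sw f₁ h₁ _ _ rfl (lit_size p _) (lit_size p _)
    change Sw _ _ (q f₁) _ _ at hs
    have e0 : ∀ k, k < 2 → ph (f₁ ⊼ f₂) k = ph f₁ k := by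
      intro k hk; simp only [ph, Form.size, lit_size]; rw [if_pos (by omega)]
    have key : ∀ (b' : Bool) (f1 : Hm _ (lit p (!b') ⋎ lit p b')) ,
        (f1 ∧∧ q (Term.id E)) ∙∙ q (HL p b E) = q (HL p b' E) →
        (f1 ∧∧ q f₂) ∙∙ q (HL p b B) = q (HL p b' E) ∙∙ q f₂ := by
      intro b' f2 hb
      rw [← hb, assoc, ← HL_nat, ← assoc, conjComp, idL, idR]
    generalize hx : q f₁ = x at hs
    generalize hn : ph f₁ 0 = n at hs
    generalize hm : ph f₁ 1 = m at hs
    cases hs with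
    | id =>
      refine Good.mk f₂ (Xi.hl b E) h₂ ?_ ?_ ?_
      · rw [q_conj, hx]
        exact key b _ (by rw [conjId, idL])
      · rw [e0 _ (pb_lt b)]; cases b <;> simp [pb, hn, hm]
      · rw [e0 _ (nb_lt b)]; cases b <;> simp [nb, hn, hm]
    | sw =>
      cases b with
      | true =>
        refine Good.mk f₂ (Xi.hl false E) h₂ ?_ ?_ ?_
        · rw [q_conj, hx]
          exact key false _ (HL_swap_true p E)
        · rw [e0 _ (pb_lt _)]; simp [pb, hn, hm]
        · rw [e0 _ (nb_lt _)]; simp [nb, hn, hm]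
      | false =>
        refine Good.mk f₂ (Xi.hl true E) h₂ ?_ ?_ ?_
        · rw [q_conj, hx]
          exact key true _ (HL_swap_false p E)
        · rw [e0 _ (pb_lt _)]; simp [pb, hn, hm]
        · rw [e0 _ (nb_lt _)]; simp [nb, hn, hm]
  | @conjL _ _ _ g kp kn cp hg =>
    have e0 : ∀ k, ph (f₁ ⊼ f₂) (A.size + k) = D.size + ph f₂ k := by
      intro k; simp only [ph]; rw [if_neg (by omega), Nat.add_sub_cancel_left]
    rcases ih₂ g _ _ _ hg with ⟨D', g', f', cp', hx, hd, e⟩ | hc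
    · refine Good.mk (f₁ ⊼ f') (hx.conjL D) ⟨h₁, hd⟩ ?_ (e0 _).symm (e0 _).symm
      rw [q_conj, q_conj, q_conj, q_conj, conjComp, conjComp, e, idL, idR]
    · right
      rw [e0, e0]
      simpa [CP] using hc.imp Or.inr Or.inr
  | @conjR _ _ _ g kp kn cp hg =>
    have hk := xi_lt hg
    have e0 : ∀ k, k < A.size → ph (f₁ ⊼ f₂) k = ph f₁ k := by
      intro k hk; simp only [ph]; rw [if_pos hk]
    rcases ih₁ g _ _ _ hg with ⟨D', g', f', cp', hx, hd, e⟩ | hc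
    · refine Good.mk (f' ⊼ f₂) (hx.conjR E) ⟨hd, h₂⟩ ?_ (e0 _ hk.1).symm (e0 _ hk.2).symm
      rw [q_conj, q_conj, q_conj, q_conj, conjComp, conjComp, e, idL, idR]
    · right
      rw [e0 _ hk.1, e0 _ hk.2]
      simp only [CP, ph_lt f₁ h₁ _ hk.1, ph_lt f₁ h₁ _ hk.2, if_true]
      exact hc.imp Or.inr Or.inr

theorem good_disj {p : P} {A B D E : Form P} (f₁ : Term P A D) (f₂ : Term P B E)
    (h₁ : IsDSTerm f₁) (h₂ : IsDSTerm f₂)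
    (ih₁ : ∀ {C : Form P} (g : Term P C A) (kp kn : ℕ) (cp : List Dir), Xi p g kp kn cp →
      Good p f₁ g kp kn)
    (ih₂ : ∀ {C : Form P} (g : Term P C B) (kp kn : ℕ) (cp : List Dir), Xi p g kp kn cp →
      Good p f₂ g kp kn)
    {C : Form P} (g : Term P C (A ⋎ B)) (kp kn : ℕ) (cp : List Dir) (hg : Xi p g kp kn cp) :
    Good p (f₁ ⊽ f₂) g kp kn := by
  cases hg with
  | @disjL _ _ _ g kp kn cp hg =>
    have e0 : ∀ k, ph (f₁ ⊽ f₂) (A.size + k) = D.size + ph f₂ k := by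
      intro k; simp only [ph]; rw [if_neg (by omega), Nat.add_sub_cancel_left]
    rcases ih₂ g _ _ _ hg with ⟨D', g', f', cp', hx, hd, e⟩ | hc
    · refine Good.mk (f₁ ⊽ f') (hx.disjL D) ⟨h₁, hd⟩ ?_ (e0 _).symm (e0 _).symm
      rw [q_disj, q_disj, q_disj, q_disj, disjComp, disjComp, e, idL, idR]
    · right
      rw [e0, e0]
      simpa [CP] using hc
  | @disjR _ _ _ g kp kn cp hg =>
    have hk := xi_lt hg
    have e0 : ∀ k, k < A.size → ph (f₁ ⊽ f₂) k = ph f₁ k := by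
      intro k hk; simp only [ph]; rw [if_pos hk]
    rcases ih₁ g _ _ _ hg with ⟨D', g', f', cp', hx, hd, e⟩ | hc
    · refine Good.mk (f' ⊽ f₂) (hx.disjR E) ⟨hd, h₂⟩ ?_ (e0 _ hk.1).symm (e0 _ hk.2).symm
      rw [q_disj, q_disj, q_disj, q_disj, disjComp, disjComp, e, idL, idR]
    · right
      rw [e0 _ hk.1, e0 _ hk.2]
      simp only [CP, ph_lt f₁ h₁ _ hk.1, ph_lt f₁ h₁ _ hk.2, if_true]
      exact hc

theorem good_bConjTo {p : P} (A B D : Form P) {C : Form P} (g : Term P C (A ⋏ (B ⋏ D)))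
    (kp kn : ℕ) (cp : List Dir) (hg : Xi p g kp kn cp) :
    Good p (Term.bConjTo A B D) g kp kn := by
  cases hg with
  | hl b => exact Good.mk1 ((Xi.hl b B).conjR D) (bTo_of_bFrom (HL_b p b B D)) rfl rfl
  | conjR _ hg =>
    refine Good.mk (Term.bConjTo _ _ _) ((hg.conjR B).conjR D) trivial ?_ rfl rfl
    rw [q_conj, ← conjId, bToNat]; rfl
  | conjL _ hg =>
    cases hg with
    | hr b =>
      exact Good.mk1 (Xi.hr b (A ⋏ B)) (bTo_of_bFrom (HR_b p b A B)) (Nat.add_assoc _ _ _)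
        (Nat.add_assoc _ _ _)
    | hl b => exact Good.mk1 ((Xi.hr b A).conjR D) (bTo_of_bFrom (tri p b A D)) rfl rfl
    | conjR _ hg =>
      refine Good.mk (Term.bConjTo _ _ _) ((hg.conjL A).conjR D) trivial ?_ rfl rfl
      rw [q_conj, q_conj, bToNat]; rfl
    | conjL _ hg =>
      refine Good.mk (Term.bConjTo _ _ _) (hg.conjL (A ⋏ B)) trivial ?_ (Nat.add_assoc _ _ _)
        (Nat.add_assoc _ _ _)
      rw [q_conj, q_conj, bToNat, conjId]; rfl

theorem good_bConjFrom {p : P} (A B D : Form P) {C : Form P} (g : Term P C ((A ⋏ B) ⋏ D))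
    (kp kn : ℕ) (cp : List Dir) (hg : Xi p g kp kn cp) :
    Good p (Term.bConjFrom A B D) g kp kn := by
  cases hg with
  | hr b =>
    exact Good.mk1 ((Xi.hr b B).conjL A) (HR_b p b A B) (Nat.add_assoc _ _ _).symm
      (Nat.add_assoc _ _ _).symm
  | conjL _ hg =>
    refine Good.mk (Term.bConjFrom _ _ _) ((hg.conjL B).conjL A) trivial ?_
      (Nat.add_assoc _ _ _).symm (Nat.add_assoc _ _ _).symm
    rw [q_conj, ← conjId, bFromNat]; rfl
  | conjR _ hg =>
    cases hg with
    | hr b => exact Good.mk1 ((Xi.hl b D).conjL A) (tri p b A D) rfl rfl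
    | hl b => exact Good.mk1 (Xi.hl b (B ⋏ D)) (HL_b p b B D) rfl rfl
    | conjL _ hg =>
      refine Good.mk (Term.bConjFrom _ _ _) ((hg.conjR D).conjL A) trivial ?_ rfl rfl
      rw [q_conj, q_conj, bFromNat]; rfl
    | conjR _ hg =>
      refine Good.mk (Term.bConjFrom _ _ _) (hg.conjR (B ⋏ D)) trivial ?_ rfl rfl
      rw [q_conj, q_conj, bFromNat, conjId]; rfl

theorem good_bDisjTo {p : P} (A B D : Form P) {C : Form P} (g : Term P C (A ⋎ (B ⋎ D)))
    (kp kn : ℕ) (cp : List Dir) (hg : Xi p g kp kn cp) :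
    Good p (Term.bDisjTo A B D) g kp kn := by
  cases hg with
  | disjR _ hg =>
    refine Good.mk (Term.bDisjTo _ _ _) ((hg.disjR B).disjR D) trivial ?_ rfl rfl
    rw [q_disj, ← disjId, dToNat]; rfl
  | disjL _ hg =>
    cases hg with
    | disjR _ hg =>
      refine Good.mk (Term.bDisjTo _ _ _) ((hg.disjL A).disjR D) trivial ?_ rfl rfl
      rw [q_disj, q_disj, dToNat]; rfl
    | disjL _ hg =>
      refine Good.mk (Term.bDisjTo _ _ _) (hg.disjL (A ⋎ B)) trivial ?_ (Nat.add_assoc _ _ _)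
        (Nat.add_assoc _ _ _)
      rw [q_disj, q_disj, dToNat, disjId]; rfl

theorem good_bDisjFrom {p : P} (A B D : Form P) {C : Form P} (g : Term P C ((A ⋎ B) ⋎ D))
    (kp kn : ℕ) (cp : List Dir) (hg : Xi p g kp kn cp) :
    Good p (Term.bDisjFrom A B D) g kp kn := by
  cases hg with
  | disjL _ hg =>
    refine Good.mk (Term.bDisjFrom _ _ _) ((hg.disjL B).disjL A) trivial ?_
      (Nat.add_assoc _ _ _).symm (Nat.add_assoc _ _ _).symm
    rw [q_disj, ← disjId, dFromNat]; rfl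
  | disjR _ hg =>
    cases hg with
    | disjL _ hg =>
      refine Good.mk (Term.bDisjFrom _ _ _) ((hg.disjR D).disjL A) trivial ?_ rfl rfl
      rw [q_disj, q_disj, dFromNat]; rfl
    | disjR _ hg =>
      refine Good.mk (Term.bDisjFrom _ _ _) (hg.disjR (B ⋎ D)) trivial ?_ rfl rfl
      rw [q_disj, q_disj, dFromNat, disjId]; rfl

theorem good_cConj {p : P} (A B : Form P) {C : Form P} (g : Term P C (A ⋏ B))
    (kp kn : ℕ) (cp : List Dir) (hg : Xi p g kp kn cp) :
    Good p (Term.cConj A B) g kp kn := by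
  cases hg with
  | hr b => exact Good.mk1 (Xi.hl b A) (HL_eq p b A).symm (by simp [ph]) (by simp [ph])
  | hl b =>
    refine Good.mk1 (Xi.hr b B) (HR_eq p b B).symm ?_ ?_
    · have := pb_lt b
      simp only [ph, Form.size, lit_size]; rw [if_pos (by omega), Nat.add_comm]
    · have := nb_lt b
      simp only [ph, Form.size, lit_size]; rw [if_pos (by omega), Nat.add_comm]
  | conjL _ hg =>
    refine Good.mk (Term.cConj _ _) (hg.conjR A) trivial ?_ (by simp [ph]) (by simp [ph])
    rw [q_conj, cConjNat]; rfl
  | conjR _ hg =>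
    have hk := xi_lt hg
    refine Good.mk (Term.cConj _ _) (hg.conjL B) trivial ?_
      (by simp only [ph]; rw [if_pos hk.1, Nat.add_comm])
      (by simp only [ph]; rw [if_pos hk.2, Nat.add_comm])
    rw [q_conj, cConjNat]; rfl

theorem good_cDisj {p : P} (A B : Form P) {C : Form P} (g : Term P C (B ⋎ A))
    (kp kn : ℕ) (cp : List Dir) (hg : Xi p g kp kn cp) :
    Good p (Term.cDisj A B) g kp kn := by
  cases hg with
  | disjL _ hg =>
    refine Good.mk (Term.cDisj _ _) (hg.disjR B) trivial ?_ (by simp [ph]) (by simp [ph])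
    rw [q_disj, cDisjNat]; rfl
  | disjR _ hg =>
    have hk := xi_lt hg
    refine Good.mk (Term.cDisj _ _) (hg.disjL A) trivial ?_
      (by simp only [ph]; rw [if_pos hk.1, Nat.add_comm])
      (by simp only [ph]; rw [if_pos hk.2, Nat.add_comm])
    rw [q_disj, cDisjNat]; rfl

theorem good_d {p : P} (A B D : Form P) {C : Form P} (g : Term P C (A ⋏ (B ⋎ D)))
    (kp kn : ℕ) (cp : List Dir) (hg : Xi p g kp kn cp) :
    Good p (Term.d A B D) g kp kn := by
  cases hg with
  | hr b =>
    right
    cases b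
    · left; simp [ph, CP, pb, Form.size, lit_size]
    · right; simp [ph, CP, nb, Form.size, lit_size]
  | hl b => exact Good.mk1 ((Xi.hl b B).disjR D) (HL_d p b B D) rfl rfl
  | conjR _ hg =>
    refine Good.mk (Term.d _ _ _) ((hg.conjR B).disjR D) trivial ?_ rfl rfl
    rw [q_conj, ← disjId, dNat]; rfl
  | conjL _ hg =>
    cases hg with
    | disjR _ hg =>
      refine Good.mk (Term.d _ _ _) ((hg.conjL A).disjR D) trivial ?_ rfl rfl
      rw [q_conj, q_disj, dNat]; rfl
    | disjL _ hg =>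
      refine Good.mk (Term.d _ _ _) (hg.disjL (A ⋏ B)) trivial ?_ (Nat.add_assoc _ _ _)
        (Nat.add_assoc _ _ _)
      rw [q_conj, q_disj, dNat, conjId]; rfl

theorem good {p : P} {D E : Form P} (f : Term P D E) (hf : IsDSTerm f) :
    ∀ {C : Form P} (g : Term P C D) (kp kn : ℕ) (cp : List Dir), Xi p g kp kn cp →
      Good p f g kp kn := by
  induction f with
  | id A =>
    intro C g kp kn cp hg
    exact Good.mk1 hg (idL _) rfl rfl
  | comp f₂ f₁ ih₂ ih₁ =>
    intro C g kp kn cp hg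
    have hk := xi_lt hg
    rcases ih₁ hf.2 g _ _ _ hg with ⟨D', g', f', cp', hx, hd, e⟩ | hc
    · rcases ih₂ hf.1 g' _ _ _ hx with ⟨D'', g'', f'', cp'', hx', hd', e'⟩ | hc
      · refine Good.mk (f'' ⬝ f') hx' ⟨hd', hd⟩ ?_ rfl rfl
        rw [q_comp, q_comp, assoc, e, ← assoc, e', assoc]
      · exact Or.inr hc
    · right
      exact hc.imp (CP_pres f₂ hf.1 _ (ph_lt f₁ hf.2 _ hk.1))
        (CP_pres f₂ hf.1 _ (ph_lt f₁ hf.2 _ hk.2))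
  | conj f g ihf ihg => exact good_conj f g hf.1 hf.2 (ihf hf.1) (ihg hf.2)
  | disj f g ihf ihg => exact good_disj f g hf.1 hf.2 (ihf hf.1) (ihg hf.2)
  | bConjTo A B C => exact good_bConjTo A B C
  | bConjFrom A B C => exact good_bConjFrom A B C
  | bDisjTo A B C => exact good_bDisjTo A B C
  | bDisjFrom A B C => exact good_bDisjFrom A B C
  | cConj A B => exact good_cConj A B
  | cDisj A B => exact good_cDisj A B
  | d A B C => exact good_d A B C
  | delta => exact hf.elim
  | sigma => exact hf.elim

end PermLemma

/-- **Ξ̂∧-Permutation Lemma**: let `g : C ⊢ D` be a `Ξ̂∧_{p,B}`-term of PN such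
that `x₁` and `¬x₂` are respectively the occurrences within `D` of `p` and `¬p`
in the crown of the head of `g`, and let `f : D ⊢ E` be an arrow term of
DS^{¬p} such that `E` has an occurrence `y₁` of `p` and an occurrence `¬y₂` of
`¬p` within a subformula occurrence of `E` of the form `y₁ ∨ ¬y₂` or `¬y₂ ∨ y₁`,
and `x_i` is linked to `y_i` in `f` for `i ∈ {1,2}`.  Then there is a
`Θ̂∧_{p,B′}`-term `g′ : D′ ⊢ E` of PN the crown of whose head is `y₁ ∨ ¬y₂` or
`¬y₂ ∨ y₁`, and an arrow term `f′ : C ⊢ D′` of DS^{¬p}, such that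
`f ∘ g = g′ ∘ f′` holds in PN. -/
theorem xiConj_permutation_lemma {P : Type} (p : P) {C D E : Form P}
    (g : Term P C D) (kp kn : ℕ) (cp : List Dir)
    (hg : IsXiConjTerm p g kp kn cp)
    (f : Term P D E) (hf : IsDSTerm f)
    (ρ : List Dir) (m₁ m₂ : ℕ)
    (hρ : (E.subAt ρ = some (Form.pos p ⋎ Form.natom p) ∧
            m₁ = E.offsetAt ρ ∧ m₂ = E.offsetAt ρ + 1) ∨
          (E.subAt ρ = some (Form.natom p ⋎ Form.pos p) ∧
            m₂ = E.offsetAt ρ ∧ m₁ = E.offsetAt ρ + 1))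
    (hl₁ : Linked f kp m₁) (hl₂ : Linked f kn m₂) :
    ∃ (D' : Form P) (g' : Term P D' E),
      IsXiConjTerm p g' m₁ m₂ ρ ∧
      ∃ f' : Term P C D', IsDSTerm f' ∧ Eqv (f ⬝ g) (g' ⬝ f') := by
  have l1 := PermLemma.linked_ph f hf hl₁
  have l2 := PermLemma.linked_ph f hf hl₂
  have s1 : ∀ b, (PermLemma.lit p b).size = 1 := PermLemma.lit_size p
  rcases PermLemma.good f hf g kp kn cp (PermLemma.xi_of hg) with
    ⟨D', g', f', cp', hx, hd, e⟩ | hc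
  · rw [← l1, ← l2] at hx
    obtain ⟨b, hs, h1, h2⟩ := PermLemma.xi_sub hx
    have hcp : cp' = ρ := by
      rcases hρ with ⟨h, a1, a2⟩ | ⟨h, a1, a2⟩
      · refine PermLemma.path_unique hs h (s1 _) (s1 _) rfl rfl ?_
        cases b <;> simp only [PermLemma.pb, PermLemma.nb] at h1 h2 <;> omega
      · refine PermLemma.path_unique hs h (s1 _) (s1 _) rfl rfl ?_
        cases b <;> simp only [PermLemma.pb, PermLemma.nb] at h1 h2 <;> omega
    subst hcp
    exact ⟨D', g', PermLemma.of_xi hx, f', hd, PermLemma.q_exact e⟩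
  · exfalso
    rw [← l1, ← l2] at hc
    rcases hρ with ⟨h, a1, a2⟩ | ⟨h, a1, a2⟩
    · have k := PermLemma.not_CP h (fun _ => id) (fun _ => id)
      simp only [Form.size] at k
      rcases hc with hc | hc
      · exact k _ (by omega) (by omega) hc
      · exact k _ (by omega) (by omega) hc
    · have k := PermLemma.not_CP h (fun _ => id) (fun _ => id)
      simp only [Form.size] at k
      rcases hc with hc | hc
      · exact k _ (by omega) (by omega) hc
      · exact k _ (by omega) (by omega) hc
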